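/- Let J be an ideal of R = K[x_1,...,x_n] such that I = Rad J is a squarefree monomial ideal. Then ara J ≤ μ(I) − μ(I)/τ(I) + 1, where μ(I) is the minimal number of monomial generators of I and τ(I) is the maximal height of a minimal prime of I. -/

import Mathlib

open MvPolynomial

/-- The arithmetical rank of an ideal: the least number of elements generating it up to
radical. -/
noncomputable def ara {R : Type*} [CommRing R] (J : Ideal R) : ℕ :=
  sInf {s : ℕ | ∃ f : Fin s → R,
    Ideal.radical (Ideal.span (Set.range f)) = Ideal.radical J}

theorem ara_le_of_radical_span_eq {R : Type*} [CommRing R] {J : Ideal R} {s : ℕ} (f : Fin s → R)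
    (hf : Ideal.radical (Ideal.span (Set.range f)) = Ideal.radical J) : ara J ≤ s :=
  Nat.sInf_le ⟨f, hf⟩

/-- If at most `k` members of a finite family lie outside a prime ideal and the first `k`
elementary symmetric functions of the family lie in it, then so does the whole family. -/
theorem Ideal.IsPrime.mem_of_esymm_mem {R ι : Type*} [CommRing R] {P : Ideal R} [hP : P.IsPrime]
    {s : Finset ι} {f : ι → R} {k : ℕ} (t : Finset ι) (ht : t ⊆ s) (htP : ∀ i ∈ t, f i ∈ P)
    (hk : s.card - t.card ≤ k) (hsymm : ∀ j < k, (s.val.map f).esymm (j + 1) ∈ P)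
    {i : ι} (hi : i ∈ s) : f i ∈ P := by
  classical
  have hall : ∀ j, (s.val.map f).esymm (j + 1) ∈ P := by
    intro j
    obtain hj | hj := lt_or_ge j k
    · exact hsymm j hj
    · rw [Finset.esymm_map_val]
      refine P.sum_mem fun u hu => ?_
      obtain ⟨hus, hucard⟩ := Finset.mem_powersetCard.mp hu
      have hnot : ¬ u ⊆ s \ t := fun h => by
        have h1 := Finset.card_le_card h
        rw [Finset.card_sdiff_of_subset ht] at h1
        omega
      obtain ⟨a, hau, hat⟩ := Finset.not_subset.mp hnot
      have hat' : a ∈ t := by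
        by_contra h
        exact hat (Finset.mem_sdiff.mpr ⟨hus hau, h⟩)
      exact hP.prod_mem_iff.mpr ⟨a, hau, htP a hat'⟩
  have hvieta := congrArg (Polynomial.eval (f i))
    (Multiset.prod_X_sub_X_eq_sum_esymm (s.val.map f))
  have hzero : Polynomial.eval (f i)
      (((s.val.map f).map fun r => Polynomial.X - Polynomial.C r).prod) = 0 := by
    rw [Polynomial.eval_multiset_prod]
    refine Multiset.prod_eq_zero ?_
    simp only [Multiset.map_map, Multiset.mem_map]
    exact ⟨i, hi, by simp⟩
  have hesymm0 : (s.val.map f).esymm 0 = 1 := by simp [Finset.esymm_map_val]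
  rw [hzero, Polynomial.eval_finsetSum, Finset.sum_range_succ'] at hvieta
  simp only [Polynomial.eval_mul, Polynomial.eval_pow, Polynomial.eval_neg, Polynomial.eval_one,
    Polynomial.eval_C, Polynomial.eval_X, pow_zero, hesymm0, one_mul,
    Nat.sub_zero] at hvieta
  refine hP.mem_of_pow_mem _ ((P.add_mem_iff_right (P.sum_mem fun j _ => ?_)).mp
    (hvieta ▸ P.zero_mem))
  exact P.mul_mem_left _ (P.mul_mem_right _ (hall j))

/-- If every variable dividing some generator `T` of a squarefree monomial ideal divides at least
`d` of its generators, then the ideal is generated up to radical by `M.card - d + 1` elements. -/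
theorem ara_le_card_sub_add_one {K σ : Type*} [Field K] [DecidableEq σ] (M : Finset (Finset σ))
    {J : Ideal (MvPolynomial σ K)}
    (hJ : J.radical = Ideal.span
      ((fun S => ∏ i ∈ S, (X i : MvPolynomial σ K)) '' (M : Set (Finset σ))))
    {T : Finset σ} (hT : T ∈ M) {d : ℕ}
    (hd : ∀ i ∈ T, d ≤ (M.filter fun S => i ∈ S).card) : ara J ≤ M.card - d + 1 := by
  set m : Finset σ → MvPolynomial σ K := fun S => ∏ i ∈ S, X i
  refine ara_le_of_radical_span_eq
    (Fin.cons (m T) fun j : Fin (M.card - d) => (M.val.map m).esymm (j + 1)) ?_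
  rw [Fin.range_cons]
  apply le_antisymm
  · rw [Ideal.radical_le_radical_iff, hJ, Ideal.span_le, Set.insert_subset_iff]
    have hmem : ∀ S ∈ M, m S ∈ Ideal.span (m '' (M : Set (Finset σ))) := fun S hS =>
      Ideal.subset_span ⟨S, hS, rfl⟩
    refine ⟨hmem T hT, ?_⟩
    rintro _ ⟨j, rfl⟩
    simp only [SetLike.mem_coe, Finset.esymm_map_val]
    refine Ideal.sum_mem _ fun u hu => ?_
    obtain ⟨hus, hucard⟩ := Finset.mem_powersetCard.mp hu
    obtain ⟨a, ha⟩ : u.Nonempty := Finset.card_pos.mp (by omega)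
    exact Ideal.mem_of_dvd _ (Finset.dvd_prod_of_mem m ha) (hmem a (hus ha))
  · rw [hJ, Ideal.radical_eq_sInf]
    refine le_sInf fun P ⟨hle, hP⟩ => ?_
    rw [Ideal.span_le, Set.insert_subset_iff] at hle
    obtain ⟨hTP, hsymm⟩ := hle
    obtain ⟨i, hiT, hiP⟩ := hP.prod_mem_iff.mp hTP
    rw [Ideal.span_le]
    rintro _ ⟨S, hS, rfl⟩
    refine hP.mem_of_esymm_mem (M.filter fun S => i ∈ S) (Finset.filter_subset _ _) ?_
      (Nat.sub_le_sub_left (hd i hiT) _) (fun j hj => hsymm ⟨⟨j, hj⟩, rfl⟩) hS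
    intro S hS
    exact hP.prod_mem_iff.mpr ⟨i, (Finset.mem_filter.mp hS).2, hiP⟩

/-- A set of variables meeting every generator of a squarefree monomial ideal contains all
variables of some minimal prime, provided the minimal primes are the ideals generated by the sets
of variables in `primes`. -/
theorem exists_subset_of_forall_inter {K σ : Type*} [Field K] {M : Finset (Finset σ)}
    {I : Ideal (MvPolynomial σ K)}
    (hI : I = Ideal.span ((fun S => ∏ i ∈ S, X i) '' (M : Set (Finset σ))))
    {primes : Finset (Finset σ)}
    (hprimes : ∀ p ∈ I.minimalPrimes,
      ∃ S ∈ primes, p = Ideal.span ((fun i => (X i : MvPolynomial σ K)) '' S))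
    (Y : Set σ) (hY : ∀ T ∈ M, ∃ i ∈ T, i ∈ Y) :
    ∃ S ∈ primes, Ideal.span ((fun i => (X i : MvPolynomial σ K)) '' S) ∈ I.minimalPrimes ∧
      ∀ i ∈ S, i ∈ Y := by
  classical
  let φ : MvPolynomial σ K →ₐ[K] MvPolynomial σ K := aeval fun i => if i ∈ Y then 0 else X i
  have hprime : (RingHom.ker φ).IsPrime := RingHom.ker_isPrime φ
  have hle : I ≤ RingHom.ker φ := by
    rw [hI, Ideal.span_le]
    rintro _ ⟨T, hT, rfl⟩
    obtain ⟨i, hiT, hiY⟩ := hY T hT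
    exact hprime.prod_mem_iff.mpr ⟨i, hiT, by simp [RingHom.mem_ker, φ, hiY]⟩
  obtain ⟨p, hp, hpφ⟩ := Ideal.exists_minimalPrimes_le hle
  obtain ⟨S, hS, rfl⟩ := hprimes p hp
  refine ⟨S, hS, hp, fun i hi => ?_⟩
  have hker : (X i : MvPolynomial σ K) ∈ RingHom.ker φ :=
    hpφ (Ideal.subset_span ⟨i, hi, rfl⟩)
  by_contra hiY
  simp [RingHom.mem_ker, φ, hiY] at hker

/-- A set of variables generating a prime over a squarefree monomial ideal meets every
generator. -/
theorem exists_mem_inter_of_le_span {K σ : Type*} [Field K] {S T : Finset σ}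
    (hp : (Ideal.span ((fun i => (X i : MvPolynomial σ K)) '' (S : Set σ))).IsPrime)
    (hT : ∏ i ∈ T, (X i : MvPolynomial σ K) ∈
      Ideal.span ((fun i => (X i : MvPolynomial σ K)) '' (S : Set σ))) :
    ∃ i ∈ S, i ∈ T := by
  obtain ⟨i, hiT, hi⟩ := hp.prod_mem_iff.mp hT
  obtain ⟨j, hj, hij⟩ := mem_ideal_span_X_image.mp hi (Finsupp.single i 1) (by simp [support_X])
  obtain rfl : i = j := by
    by_contra h
    exact hij (by simp [h])
  exact ⟨i, hj, hiT⟩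

theorem ara_le_mu_sub_mu_div_tau_add_one {K : Type*} [Field K] (n : ℕ)
    (M : Finset (Finset (Fin n))) (I J : Ideal (MvPolynomial (Fin n) K))
    -- the radical of `J` is the squarefree monomial ideal `I`
    (hJ : Ideal.radical J = I)
    -- `M` is the minimal generating set of squarefree monomials for `I`
    (hI : I = Ideal.span ((fun S => ∏ i ∈ S, X i) '' (M : Set (Finset (Fin n)))))
    (hmin : ∀ M' : Finset (Finset (Fin n)), M' ⊂ M →
      Ideal.span ((fun S => ∏ i ∈ S, X i) '' (M' : Set (Finset (Fin n)))) ≠ I)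
    -- the minimal primes of `I` are exactly the ideals generated by the sets of
    -- variables listed in `primes`; the height of such a prime is the number of variables
    (primes : Finset (Finset (Fin n))) (hne : primes.Nonempty)
    (hprimes : ∀ p : Ideal (MvPolynomial (Fin n) K), p ∈ I.minimalPrimes ↔
      ∃ S ∈ primes, p = Ideal.span ((fun i => (X i : MvPolynomial (Fin n) K)) '' S)) :
    (ara J : ℝ) ≤ (M.card : ℝ) -
      (M.card : ℝ) / (primes.sup' hne (fun S => S.card) : ℝ) + 1 := by
  obtain rfl | hM := M.eq_empty_or_nonempty
  · have h0 : ara J ≤ 0 := ara_le_of_radical_span_eq Fin.elim0 (by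
      rw [hJ, hI]
      simp)
    have h0' : ara J = 0 := by omega
    simp [h0']
  have hcard : (0 : ℝ) < M.card := by exact_mod_cast hM.card_pos
  set τ : ℝ := primes.sup' hne fun S => (S.card : ℝ) with hτ
  obtain ⟨T, hTM, hT⟩ : ∃ T ∈ M, ∀ i ∈ T,
      (M.card : ℝ) / τ ≤ ((M.filter fun S => i ∈ S).card : ℝ) := by
    by_contra! h
    obtain ⟨S, hS, hSmin, hSY⟩ := exists_subset_of_forall_inter hI
      (fun p hp => (hprimes p).mp hp)
      {i | ((M.filter fun S => i ∈ S).card : ℝ) < (M.card : ℝ) / τ} h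
    have hcover : M ⊆ S.biUnion fun i => M.filter fun T => i ∈ T := by
      intro T hT
      obtain ⟨i, hiS, hiT⟩ := exists_mem_inter_of_le_span hSmin.1.1
        (hSmin.1.2 (hI.ge (Ideal.subset_span ⟨T, hT, rfl⟩)))
      exact Finset.mem_biUnion.mpr ⟨i, hiS, Finset.mem_filter.mpr ⟨hT, hiT⟩⟩
    have hle : M.card ≤ ∑ i ∈ S, (M.filter fun T => i ∈ T).card :=
      (Finset.card_le_card hcover).trans Finset.card_biUnion_le
    have hSne : S.Nonempty := by
      rw [Finset.nonempty_iff_ne_empty]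
      rintro rfl
      simp at hle
      exact hM.ne_empty hle
    have hSτ : (S.card : ℝ) ≤ τ := Finset.le_sup' (fun S => (S.card : ℝ)) hS
    have hτpos : (0 : ℝ) < τ := lt_of_lt_of_le (by exact_mod_cast hSne.card_pos) hSτ
    have hlt : (M.card : ℝ) < M.card := calc
      (M.card : ℝ) ≤ ∑ i ∈ S, ((M.filter fun T => i ∈ T).card : ℝ) := by exact_mod_cast hle
      _ < ∑ _i ∈ S, (M.card : ℝ) / τ := Finset.sum_lt_sum_of_nonempty hSne hSY
      _ = S.card * ((M.card : ℝ) / τ) := by simp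
      _ ≤ τ * ((M.card : ℝ) / τ) := by gcongr
      _ = M.card := by field_simp
    exact lt_irrefl _ hlt
  have hara := ara_le_card_sub_add_one M (hJ.trans hI) hTM
    (d := ⌈(M.card : ℝ) / τ⌉₊) fun i hi => Nat.ceil_le.mpr (hT i hi)
  have hdle : ⌈(M.card : ℝ) / τ⌉₊ ≤ M.card := Nat.ceil_le.mpr (by
    obtain ⟨S, -, hS⟩ := Finset.exists_mem_eq_sup' hne fun S => (S.card : ℝ)
    rw [hτ, hS]
    obtain h | h := Nat.eq_zero_or_pos S.card
    · simp [h]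
    · exact div_le_self hcard.le (by exact_mod_cast h))
  have hara' : (ara J : ℝ) ≤ M.card - ⌈(M.card : ℝ) / τ⌉₊ + 1 := by
    rw [← Nat.cast_sub hdle]
    exact_mod_cast hara
  linarith [Nat.le_ceil ((M.card : ℝ) / τ)]
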